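/- The map (x, y) ↦ x ▷ y is a left action of the monoid (W, ∗) on the set W: for all x, x', y ∈ W one has e ▷ y = y and (x ∗ x') ▷ y = x ▷ (x' ▷ y). -/

import Mathlib

/-! Common setup: a finite Coxeter system, Bruhat order, and the sets
`{u * y : u ≤ x}` and `{x * v : v ≤ y}` used to characterize the
Demazure product `∗` and the operations `▷`, `◁`. -/

/-- The Bruhat order on a Coxeter group: the reflexive-transitive closure of
the relation `u → u * t`, where `t` is a reflection and right multiplication
by `t` increases length. -/
def CoxeterSystem.bruhatLE {B W : Type*} [Group W] {M : CoxeterMatrix B}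
    (cs : CoxeterSystem M W) : W → W → Prop :=
  Relation.ReflTransGen
    (fun u v => ∃ t, cs.IsReflection t ∧ v = u * t ∧ cs.length u < cs.length v)

/-- The set `{u * y : u ∈ W, u ≤ x}`. -/
def CoxeterSystem.lset {B W : Type*} [Group W] {M : CoxeterMatrix B}
    (cs : CoxeterSystem M W) (x y : W) : Set W :=
  {z | ∃ u, cs.bruhatLE u x ∧ z = u * y}

/-- The set `{x * v : v ∈ W, v ≤ y}`. -/
def CoxeterSystem.rset {B W : Type*} [Group W] {M : CoxeterMatrix B}
    (cs : CoxeterSystem M W) (x y : W) : Set W :=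
  {z | ∃ v, cs.bruhatLE v y ∧ z = x * v}

namespace CoxeterSystem

variable {B W : Type*} [Group W] {M : CoxeterMatrix B} (cs : CoxeterSystem M W)

section Inversions

open Classical in
/-- The involution of `W × ZMod 2` that conjugates the first coordinate by a simple reflection
and flips the second coordinate exactly when the first one is that reflection. -/
noncomputable def signedConj (i : B) : Equiv.Perm (W × ZMod 2) :=
  Function.Involutive.toPerm
    (fun p => (cs.simple i * p.1 * cs.simple i, p.2 + if p.1 = cs.simple i then 1 else 0))
    (by
      rintro ⟨t, ε⟩
      have h : cs.simple i * t * cs.simple i = cs.simple i ↔ t = cs.simple i := by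
        rw [mul_assoc, mul_eq_left, mul_eq_one_iff_eq_inv, cs.inv_simple]
      ext
      · simp [mul_assoc]
      · simp only [h, add_assoc, CharTwo.add_self_eq_zero, add_zero])

open Classical in
theorem signedConj_apply (i : B) (t : W) (ε : ZMod 2) :
    cs.signedConj i (t, ε) =
      (cs.simple i * t * cs.simple i, ε + if t = cs.simple i then 1 else 0) := rfl

open Classical in
theorem signedConj_mul_pow_apply (i j : B) (k : ℕ) (t : W) (ε : ZMod 2) :
    ((cs.signedConj i * cs.signedConj j) ^ k) (t, ε) =
      ((cs.simple i * cs.simple j) ^ k * t * ((cs.simple i * cs.simple j) ^ k)⁻¹,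
        ε + ∑ q ∈ Finset.range (2 * k),
          if t = cs.simple j * (cs.simple i * cs.simple j) ^ q then 1 else 0) := by
  induction k with
  | zero => simp
  | succ k ih =>
    set c := cs.simple i * cs.simple j with hc
    have hcj : c * cs.simple j = cs.simple i := by simp [hc]
    have hjc : ∀ n : ℕ, cs.simple j * c ^ n * cs.simple j = (c ^ n)⁻¹ := by
      intro n
      have h := conj_pow (a := cs.simple j) (b := c) (i := n)
      rw [cs.inv_simple] at h
      rw [← h, ← inv_pow]
      congr 1
      simp [hc, mul_assoc]
    have hjc' : ∀ n : ℕ, (c ^ n)⁻¹ * cs.simple j = cs.simple j * c ^ n := by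
      intro n
      rw [← hjc, cs.simple_mul_simple_cancel_right]
    have h₀ : c ^ k * t * (c ^ k)⁻¹ = cs.simple j ↔ t = cs.simple j * c ^ (2 * k) := by
      rw [mul_inv_eq_iff_eq_mul, ← eq_inv_mul_iff_mul_eq, ← mul_assoc, hjc', mul_assoc, ← pow_add,
        two_mul]
    have h₁ : cs.simple j * (c ^ k * t * (c ^ k)⁻¹) * cs.simple j = cs.simple i ↔
        t = cs.simple j * c ^ (2 * k + 1) := by
      rw [← hcj, mul_left_inj, ← eq_inv_mul_iff_mul_eq, mul_inv_eq_iff_eq_mul,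
        ← eq_inv_mul_iff_mul_eq, cs.inv_simple]
      rw [show (c ^ k)⁻¹ * (cs.simple j * c * c ^ k) = (c ^ k)⁻¹ * cs.simple j * (c * c ^ k) by
        group, hjc', mul_assoc, ← pow_succ', ← pow_add]
      ring_nf
    rw [pow_succ', Equiv.Perm.mul_apply, ih, Equiv.Perm.mul_apply, signedConj_apply,
      signedConj_apply, h₀, h₁, show 2 * (k + 1) = 2 * k + 1 + 1 by ring, Finset.sum_range_succ,
      Finset.sum_range_succ]
    ext
    · simp [hc, pow_succ', mul_assoc]
    · simp only [add_assoc]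

theorem isLiftable_signedConj : M.IsLiftable cs.signedConj := by
  classical
  intro i j
  ext1 ⟨t, ε⟩
  rw [signedConj_mul_pow_apply, cs.simple_mul_simple_pow, two_mul, Finset.sum_range_add]
  simp [pow_add, CharTwo.add_self_eq_zero]

/-- The action of `W` on `W × ZMod 2` extending `signedConj`. -/
noncomputable def signedConjHom : W →* Equiv.Perm (W × ZMod 2) :=
  cs.lift ⟨cs.signedConj, cs.isLiftable_signedConj⟩

theorem signedConjHom_simple (i : B) : cs.signedConjHom (cs.simple i) = cs.signedConj i :=
  cs.lift_apply_simple _ i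

/-- The cocycle of `signedConjHom`; on reflections it is the indicator of right inversions. -/
noncomputable def inversionParity (w t : W) : ZMod 2 := (cs.signedConjHom w (t, 0)).2

theorem signedConjHom_apply (w t : W) (ε : ZMod 2) :
    cs.signedConjHom w (t, ε) = (w * t * w⁻¹, ε + cs.inversionParity w t) := by
  unfold inversionParity
  induction w using cs.simple_induction_left generalizing t ε with
  | one => simp
  | mul_simple_left w i ih =>
    rw [map_mul, Equiv.Perm.mul_apply, Equiv.Perm.mul_apply, ih t ε, ih t 0, signedConjHom_simple,
      signedConj_apply, signedConj_apply]
    simp [mul_assoc, add_assoc]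

theorem inversionParity_mul (v w t : W) :
    cs.inversionParity (v * w) t =
      cs.inversionParity w t + cs.inversionParity v (w * t * w⁻¹) := by
  rw [inversionParity, map_mul, Equiv.Perm.mul_apply, signedConjHom_apply, signedConjHom_apply,
    zero_add]

theorem inversionParity_one (t : W) : cs.inversionParity 1 t = 0 := by
  simp [inversionParity]

open Classical in
theorem inversionParity_simple (i : B) (t : W) :
    cs.inversionParity (cs.simple i) t = if t = cs.simple i then 1 else 0 := by
  rw [inversionParity, signedConjHom_simple, signedConj_apply, zero_add]

theorem mem_rightInvSeq_of_inversionParity_ne_zero (ω : List B) (t : W)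
    (h : cs.inversionParity (cs.wordProd ω) t ≠ 0) : t ∈ cs.rightInvSeq ω := by
  classical
  induction ω with
  | nil => simp [inversionParity_one] at h
  | cons i ω ih =>
    rw [wordProd_cons, inversionParity_mul, inversionParity_simple] at h
    rw [rightInvSeq, List.mem_cons]
    by_cases h₀ : cs.inversionParity (cs.wordProd ω) t = 0
    · left
      rw [h₀, zero_add, ne_eq, ite_eq_right_iff, Classical.not_imp] at h
      rw [← h.1]
      group
    · exact Or.inr (ih h₀)

theorem length_mul_lt_of_inversionParity_ne_zero {w t : W} (h : cs.inversionParity w t ≠ 0) :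
    cs.length (w * t) < cs.length w := by
  obtain ⟨ω, hω, rfl⟩ := cs.exists_isReduced w
  exact (cs.isRightInversion_of_mem_rightInvSeq hω
    (cs.mem_rightInvSeq_of_inversionParity_ne_zero ω t h)).2

theorem IsReflection.inversionParity_self {cs : CoxeterSystem M W} {t : W}
    (ht : cs.IsReflection t) : cs.inversionParity t t = 1 := by
  obtain ⟨w, i, rfl⟩ := ht
  have h := cs.inversionParity_mul w w⁻¹ (w * cs.simple i * w⁻¹)
  rw [mul_inv_cancel, inversionParity_one] at h
  have e : w⁻¹ * (w * cs.simple i * w⁻¹) * w⁻¹⁻¹ = cs.simple i := by group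
  rw [inversionParity_mul, inversionParity_mul, e, inversionParity_simple]
  rw [e] at h
  simp only [if_true, cs.inv_simple, cs.simple_mul_simple_self, one_mul]
  linear_combination -h

theorem IsReflection.length_lt_length_mul_iff {cs : CoxeterSystem M W} {t : W}
    (ht : cs.IsReflection t) (w : W) :
    cs.length w < cs.length (w * t) ↔ cs.inversionParity w t = 0 := by
  refine ⟨fun h => ?_, fun h => ?_⟩
  · by_contra h₀
    exact h.not_gt (cs.length_mul_lt_of_inversionParity_ne_zero h₀)
  · have h₁ : cs.inversionParity (w * t) t ≠ 0 := by
      rw [inversionParity_mul, ht.inversionParity_self, mul_inv_cancel_right, h]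
      simp
    simpa [mul_assoc, ht.mul_self] using cs.length_mul_lt_of_inversionParity_ne_zero h₁

/-- Left multiplication by a simple reflection preserves the generating relation of the Bruhat
order, except on the edges it reverses. -/
theorem IsReflection.simple_mul_lt_or_eq {cs : CoxeterSystem M W} {t : W}
    (ht : cs.IsReflection t) {w : W} (h : cs.length w < cs.length (w * t)) (i : B) :
    cs.length (cs.simple i * w) < cs.length (cs.simple i * w * t) ∨ w * t = cs.simple i * w := by
  by_cases e : w * t * w⁻¹ = cs.simple i
  · exact Or.inr (mul_inv_eq_iff_eq_mul.mp e)
  · left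
    rw [ht.length_lt_length_mul_iff] at h ⊢
    rw [inversionParity_mul, inversionParity_simple, if_neg e, h, add_zero]

end Inversions

section Bruhat

variable {cs}

theorem bruhatLE.length_le {u v : W} (h : cs.bruhatLE u v) : cs.length u ≤ cs.length v := by
  induction h with
  | refl => rfl
  | tail _ h ih =>
    obtain ⟨t, -, -, h⟩ := h
    exact ih.trans h.le

theorem bruhatLE.antisymm {u v : W} (h : cs.bruhatLE u v) (h' : cs.bruhatLE v u) : u = v := by
  rcases Relation.ReflTransGen.cases_tail h with rfl | ⟨w, hw, t, -, -, hlt⟩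
  · rfl
  · exact absurd (hlt.trans_le (h'.length_le.trans (bruhatLE.length_le hw))) (lt_irrefl _)

theorem bruhatLE_simple_mul {w : W} {i : B} (h : cs.length w < cs.length (cs.simple i * w)) :
    cs.bruhatLE w (cs.simple i * w) :=
  .single ⟨w⁻¹ * cs.simple i * w, ⟨w⁻¹, i, by simp⟩, by group, h⟩

theorem bruhatLE_of_length_simple_mul_lt {w : W} {i : B}
    (h : cs.length (cs.simple i * w) < cs.length w) : cs.bruhatLE (cs.simple i * w) w := by
  have := bruhatLE_simple_mul (cs := cs) (w := cs.simple i * w) (i := i) (by simpa using h)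
  simpa using this

theorem bruhatLE.simple_mul_left {u v : W} (h : cs.bruhatLE u v) (i : B) :
    cs.bruhatLE (cs.simple i * u) v ∨ cs.bruhatLE (cs.simple i * u) (cs.simple i * v) := by
  induction h with
  | refl => exact Or.inr .refl
  | tail _ hstep ih =>
    have hstep' := hstep
    obtain ⟨t, ht, rfl, hlt⟩ := hstep
    rcases ih with ih | ih
    · exact Or.inl (.tail ih hstep')
    · rcases ht.simple_mul_lt_or_eq hlt i with h | h
      · exact Or.inr (.tail ih ⟨t, ht, (mul_assoc _ _ _).symm, by rwa [← mul_assoc]⟩)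
      · exact Or.inl (h ▸ ih)

theorem bruhatLE.simple_mul_right {u v : W} (h : cs.bruhatLE u v) (i : B) :
    cs.bruhatLE u (cs.simple i * v) ∨ cs.bruhatLE (cs.simple i * u) (cs.simple i * v) := by
  induction h using Relation.ReflTransGen.head_induction_on with
  | refl => exact Or.inr .refl
  | head hstep _ ih =>
    have hstep' := hstep
    obtain ⟨t, ht, rfl, hlt⟩ := hstep
    rcases ih with ih | ih
    · exact Or.inl (.head hstep' ih)
    · rcases ht.simple_mul_lt_or_eq hlt i with h | h
      · exact Or.inr (.head ⟨t, ht, (mul_assoc _ _ _).symm, by rwa [← mul_assoc]⟩ ih)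
      · rw [h, cs.simple_mul_simple_cancel_left] at ih
        exact Or.inl ih

theorem bruhatLE_simple_mul_iff {x : W} {i : B} (hx : cs.length x < cs.length (cs.simple i * x))
    (u : W) :
    cs.bruhatLE u (cs.simple i * x) ↔ cs.bruhatLE u x ∨ cs.bruhatLE (cs.simple i * u) x := by
  constructor
  · intro h
    simpa using h.simple_mul_right i
  · rintro (h | h)
    · exact h.trans (bruhatLE_simple_mul hx)
    · rcases h.simple_mul_left i with h | h
      · rw [cs.simple_mul_simple_cancel_left] at h
        exact h.trans (bruhatLE_simple_mul hx)
      · rwa [cs.simple_mul_simple_cancel_left] at h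

theorem mem_lset_simple_mul_iff {x : W} {i : B} (hx : cs.length x < cs.length (cs.simple i * x))
    (y z : W) :
    z ∈ cs.lset (cs.simple i * x) y ↔ z ∈ cs.lset x y ∨ cs.simple i * z ∈ cs.lset x y := by
  have key : ∀ x z : W, z ∈ cs.lset x y ↔ cs.bruhatLE (z * y⁻¹) x := fun x z =>
    ⟨by rintro ⟨u, hu, rfl⟩; simpa using hu, fun h => ⟨_, h, by simp⟩⟩
  rw [key, key, key, bruhatLE_simple_mul_iff hx, mul_assoc]

variable (cs) in
/-- The larger of `w` and `s i * w`. -/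
noncomputable def simpleUp (i : B) (w : W) : W :=
  if cs.length w < cs.length (cs.simple i * w) then cs.simple i * w else w

variable (cs) in
/-- The smaller of `w` and `s i * w`. -/
noncomputable def simpleDown (i : B) (w : W) : W :=
  if cs.length w < cs.length (cs.simple i * w) then w else cs.simple i * w

theorem simple_mul_length_lt_of_not_lt {i : B} {w : W}
    (h : ¬cs.length w < cs.length (cs.simple i * w)) :
    cs.length (cs.simple i * w) < cs.length w :=
  (not_lt.mp h).lt_of_ne (cs.length_simple_mul_ne w i)

theorem bruhatLE_simpleUp (i : B) (w : W) :
    cs.bruhatLE w (cs.simpleUp i w) ∧ cs.bruhatLE (cs.simple i * w) (cs.simpleUp i w) := by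
  unfold simpleUp
  split_ifs with h
  · exact ⟨bruhatLE_simple_mul h, .refl⟩
  · exact ⟨.refl, bruhatLE_of_length_simple_mul_lt (simple_mul_length_lt_of_not_lt h)⟩

theorem simpleDown_bruhatLE (i : B) (w : W) :
    cs.bruhatLE (cs.simpleDown i w) w ∧ cs.bruhatLE (cs.simpleDown i w) (cs.simple i * w) := by
  unfold simpleDown
  split_ifs with h
  · exact ⟨.refl, bruhatLE_simple_mul h⟩
  · exact ⟨bruhatLE_of_length_simple_mul_lt (simple_mul_length_lt_of_not_lt h), .refl⟩

theorem simpleDown_simpleDown (i : B) (w : W) :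
    cs.simpleDown i (cs.simpleDown i w) = cs.simpleDown i w := by
  by_cases h : cs.length w < cs.length (cs.simple i * w)
  · simp [simpleDown, h]
  · simp [simpleDown, h, simple_mul_length_lt_of_not_lt h]

theorem eq_simpleUp_of_isGreatest {x y m m' : W} {i : B}
    (hx : cs.length x < cs.length (cs.simple i * x))
    (hm : m ∈ cs.lset x y ∧ ∀ z ∈ cs.lset x y, cs.bruhatLE z m)
    (hm' : m' ∈ cs.lset (cs.simple i * x) y ∧
      ∀ z ∈ cs.lset (cs.simple i * x) y, cs.bruhatLE z m') :
    m' = cs.simpleUp i m := by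
  have hup := bruhatLE_simpleUp (cs := cs) i m
  simp only [mem_lset_simple_mul_iff hx] at hm'
  refine bruhatLE.antisymm ?_ (hm'.2 _ ?_)
  · rcases hm'.1 with h | h
    · exact (hm.2 _ h).trans hup.1
    · rcases (hm.2 _ h).simple_mul_left i with h | h <;>
        rw [cs.simple_mul_simple_cancel_left] at h
      · exact h.trans hup.1
      · exact h.trans hup.2
  · unfold simpleUp
    split_ifs
    · exact Or.inr (by simpa using hm.1)
    · exact Or.inl hm.1

theorem eq_simpleDown_of_isLeast {x y m m' : W} {i : B}
    (hx : cs.length x < cs.length (cs.simple i * x))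
    (hm : m ∈ cs.lset x y ∧ ∀ z ∈ cs.lset x y, cs.bruhatLE m z)
    (hm' : m' ∈ cs.lset (cs.simple i * x) y ∧
      ∀ z ∈ cs.lset (cs.simple i * x) y, cs.bruhatLE m' z) :
    m' = cs.simpleDown i m := by
  have hdown := simpleDown_bruhatLE (cs := cs) i m
  simp only [mem_lset_simple_mul_iff hx] at hm'
  refine bruhatLE.antisymm (hm'.2 _ ?_) ?_
  · unfold simpleDown
    split_ifs
    · exact Or.inl hm.1
    · exact Or.inr (by simpa using hm.1)
  · rcases hm'.1 with h | h
    · exact hdown.1.trans (hm.2 _ h)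
    · rcases (hm.2 _ h).simple_mul_right i with h | h <;>
        rw [cs.simple_mul_simple_cancel_left] at h
      · exact hdown.1.trans h
      · exact hdown.2.trans h

theorem mem_lset_one_iff {y z : W} : z ∈ cs.lset 1 y ↔ z = y := by
  constructor
  · rintro ⟨u, hu, rfl⟩
    have := hu.length_le
    rw [cs.length_one, Nat.le_zero, cs.length_eq_zero_iff] at this
    rw [this, one_mul]
  · rintro rfl
    exact ⟨1, .refl, (one_mul _).symm⟩

/-- Induction on the length of an element, adding simple reflections on the left. -/
theorem length_induction_left {p : W → Prop} (one : p 1)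
    (simple_mul : ∀ (x : W) (i : B), cs.length x < cs.length (cs.simple i * x) → p x →
      p (cs.simple i * x)) (x : W) : p x := by
  induction h : cs.length x using Nat.strong_induction_on generalizing x with
  | _ n ih =>
    by_cases hx : x = 1
    · exact hx ▸ one
    · obtain ⟨i, hi⟩ := cs.exists_leftDescent_of_ne_one hx
      have := simple_mul (cs.simple i * x) i
        (by rwa [cs.simple_mul_simple_cancel_left]) (ih _ (h ▸ hi) _ rfl)
      simpa using this

end Bruhat

end CoxeterSystem

/-- The map `(x, y) ↦ x ▷ y` is a left action of the monoid `(W, ∗)` on `W`: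
`e ▷ y = y` and `(x ∗ x') ▷ y = x ▷ (x' ▷ y)`. -/
theorem rtr_left_monoid_action {B W : Type*} [Group W] [Finite W] {M : CoxeterMatrix B}
    (cs : CoxeterSystem M W) (star rtr : W → W → W)
    (hstar : ∀ x y : W, star x y ∈ cs.lset x y ∧
      ∀ z ∈ cs.lset x y, cs.bruhatLE z (star x y))
    (hrtr : ∀ x y : W, rtr x y ∈ cs.lset x y ∧
      ∀ z ∈ cs.lset x y, cs.bruhatLE (rtr x y) z) :
    (∀ y : W, rtr 1 y = y) ∧
    (∀ x x' y : W, rtr (star x x') y = rtr x (rtr x' y)) := by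
  have hone : ∀ y, rtr 1 y = y := fun y => CoxeterSystem.mem_lset_one_iff.mp (hrtr 1 y).1
  have hdown : ∀ (x : W) (i : B), cs.length x < cs.length (cs.simple i * x) → ∀ y,
      rtr (cs.simple i * x) y = cs.simpleDown i (rtr x y) := fun x i hx y =>
    CoxeterSystem.eq_simpleDown_of_isLeast hx (hrtr x y) (hrtr _ y)
  refine ⟨hone, fun x x' y => ?_⟩
  induction x using CoxeterSystem.length_induction_left (cs := cs) with
  | one => rw [hone, CoxeterSystem.mem_lset_one_iff.mp (hstar 1 x').1]
  | simple_mul x i hx ih =>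
    rw [CoxeterSystem.eq_simpleUp_of_isGreatest hx (hstar x x') (hstar _ x'), hdown x i hx, ← ih,
      CoxeterSystem.simpleUp]
    split_ifs with h
    · exact hdown _ i h y
    · have hz := hdown (cs.simple i * star x x') i
        (by simpa using CoxeterSystem.simple_mul_length_lt_of_not_lt h) y
      rw [cs.simple_mul_simple_cancel_left] at hz
      rw [hz, CoxeterSystem.simpleDown_simpleDown]
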